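/- arXiv:2207.01108 — 6 statements merged into one kernel-verified Lean document; each statement's English description precedes it below -/
import Mathlib

section
/- Let t ≥ 1 and n ≥ 1 be integers. For every pair (i, j) with 1 ≤ i ≤ t and 1 ≤ j ≤ n, let σ(i,j) be the closed segment in ℝ² from ((j−1)·t + i, 1) to ((n−j)·t + i, 0). Then for any two distinct pairs (i, j) ≠ (i', j'), the segments σ(i,j) and σ(i',j') are disjoint if and only if j = j' (in which case the two segments are parallel); if j ≠ j', they intersect. -/
/-- Two segments joining the lines `y = 1` and `y = 0` are disjoint iff their endpoints occur in the
same strict order on both lines. -/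
theorem disjoint_segment_iff_mul_pos (p q p' q' : ℝ) :
    Disjoint (segment ℝ ((p, 1) : ℝ × ℝ) (q, 0)) (segment ℝ ((p', 1) : ℝ × ℝ) (q', 0)) ↔
      0 < (p - p') * (q - q') := by
  have meet_iff : ¬ Disjoint (segment ℝ ((p, 1) : ℝ × ℝ) (q, 0))
      (segment ℝ ((p', 1) : ℝ × ℝ) (q', 0)) ↔ (0 : ℝ) ∈ segment ℝ (p - p') (q - q') := by
    rw [Set.not_disjoint_iff]
    constructor
    · rintro ⟨_, ⟨a, b, ha, hb, hab, rfl⟩, c, d, -, -, hcd, h⟩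
      simp only [Prod.smul_mk, Prod.mk_add_mk, Prod.mk.injEq, smul_eq_mul, mul_one, mul_zero,
        add_zero] at h
      obtain ⟨hx, rfl⟩ := h
      obtain rfl : d = b := by linarith
      exact ⟨c, d, ha, hb, hab, by simp only [smul_eq_mul]; linarith⟩
    · rintro ⟨a, b, ha, hb, hab, h⟩
      simp only [smul_eq_mul] at h
      refine ⟨_, ⟨a, b, ha, hb, hab, rfl⟩, a, b, ha, hb, hab, ?_⟩
      simp only [Prod.smul_mk, Prod.mk_add_mk, Prod.mk.injEq, smul_eq_mul, and_true]
      linarith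
  rw [← not_iff_not, meet_iff, segment_eq_uIcc, Set.mem_uIcc, not_lt, mul_nonpos_iff]
  tauto

/-- For 1 ≤ i,i' ≤ t and 1 ≤ j,j' ≤ n, the segments σ(i,j) from ((j−1)t+i, 1) to
((n−j)t+i, 0) and σ(i',j') are disjoint iff j = j' (for distinct pairs (i,j) ≠ (i',j')). -/
theorem stmt_1 (t n : ℕ) (ht : 1 ≤ t) (hn : 1 ≤ n)
    (i j i' j' : ℕ)
    (hi1 : 1 ≤ i) (hit : i ≤ t) (hj1 : 1 ≤ j) (hjn : j ≤ n)
    (hi1' : 1 ≤ i') (hit' : i' ≤ t) (hj1' : 1 ≤ j') (hjn' : j' ≤ n)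
    (hne : (i, j) ≠ (i', j')) :
    Disjoint
      (segment ℝ ((((j : ℝ) - 1) * t + i, 1) : ℝ × ℝ) ((((n : ℝ) - j) * t + i, 0) : ℝ × ℝ))
      (segment ℝ ((((j' : ℝ) - 1) * t + i', 1) : ℝ × ℝ) ((((n : ℝ) - j') * t + i', 0) : ℝ × ℝ))
      ↔ j = j' := by
  rw [disjoint_segment_iff_mul_pos]
  have key : (((j : ℝ) - 1) * t + i - (((j' : ℝ) - 1) * t + i')) *
      (((n : ℝ) - j) * t + i - (((n : ℝ) - j') * t + i')) =
      ((i : ℝ) - i') ^ 2 - (((j : ℝ) - j') * t) ^ 2 := by ring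
  rw [key, sub_pos, sq_lt_sq]
  constructor
  · intro h
    by_contra hj
    have hgap : (1 : ℝ) ≤ |(j : ℝ) - j'| := by
      exact_mod_cast Int.one_le_abs (sub_ne_zero.mpr (Nat.cast_injective.ne hj : (j : ℤ) ≠ j'))
    have hle : |(i : ℝ) - i'| ≤ t := by
      have : |(i : ℤ) - i'| ≤ t := abs_le.mpr ⟨by omega, by omega⟩
      exact_mod_cast this
    rw [abs_mul, Nat.abs_cast] at h
    linarith [le_mul_of_one_le_left (Nat.cast_nonneg (α := ℝ) t) hgap]
  · rintro rfl
    have hi : i ≠ i' := fun h => hne (by rw [h])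
    simpa [sub_eq_zero] using hi
end

section
/- Let t ≥ 1 and n ≥ 1 be integers, and for 1 ≤ i ≤ t, 1 ≤ j ≤ n let σ(i,j) be the closed segment in ℝ² from ((j−1)·t + i, 1) to ((n−j)·t + i, 0). Let S be a nonempty subset of {1,…,t} × {1,…,n}. Then the maximum cardinality of a subset T ⊆ S such that the segments {σ(i,j) : (i,j) ∈ T} are pairwise disjoint equals the maximum over j ∈ {1,…,n} of the number of indices i with (i,j) ∈ S. -/
open scoped Classical

/-- The segment σ(i,j) from ((j−1)t+i, 1) to ((n−j)t+i, 0), for p = (i,j). -/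
noncomputable def sigSeg (t n : ℕ) (p : ℕ × ℕ) : Set (ℝ × ℝ) :=
  segment ℝ ((((p.2 : ℝ) - 1) * t + p.1, 1) : ℝ × ℝ) ((((n : ℝ) - p.2) * t + p.1, 0) : ℝ × ℝ)

theorem mem_segment_strip_iff {a b : ℝ} {z : ℝ × ℝ} :
    z ∈ segment ℝ ((a, 1) : ℝ × ℝ) ((b, 0) : ℝ × ℝ) ↔
      0 ≤ z.2 ∧ z.2 ≤ 1 ∧ z.1 = z.2 * a + (1 - z.2) * b := by
  obtain ⟨x, y⟩ := z
  constructor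
  · rintro ⟨c, d, hc, hd, hcd, h⟩
    simp only [Prod.smul_mk, Prod.mk_add_mk, smul_eq_mul, mul_one, mul_zero, add_zero,
      Prod.mk.injEq] at h
    obtain ⟨rfl, rfl⟩ := h
    refine ⟨hc, by linarith, ?_⟩
    rw [← hcd]
    ring
  · rintro ⟨h0, h1, h⟩
    refine ⟨y, 1 - y, h0, by linarith, by ring, ?_⟩
    simp only at h
    simp [h]

/-- Two segments across the strip `0 ≤ y ≤ 1` whose endpoints occur in opposite orders on the two
boundary lines meet. -/
theorem not_disjoint_segment_strip {a b c d : ℝ} (htop : a < c) (hbot : d < b) :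
    ¬ Disjoint (segment ℝ ((a, 1) : ℝ × ℝ) ((b, 0) : ℝ × ℝ))
      (segment ℝ ((c, 1) : ℝ × ℝ) ((d, 0) : ℝ × ℝ)) := by
  have hD : 0 < (b - d) + (c - a) := by linarith
  set y := (b - d) / ((b - d) + (c - a)) with hy
  have h0 : 0 ≤ y := div_nonneg (by linarith) hD.le
  have h1 : y ≤ 1 := (div_le_one hD).2 (by linarith)
  have hyD : y * ((b - d) + (c - a)) = b - d := div_mul_cancel₀ _ hD.ne'
  refine Set.not_disjoint_iff.2 ⟨(y * a + (1 - y) * b, y), ?_, ?_⟩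
  · exact mem_segment_strip_iff.2 ⟨h0, h1, rfl⟩
  · exact mem_segment_strip_iff.2 ⟨h0, h1, by simp only; linarith⟩

theorem disjoint_sigSeg_of_snd_eq (t n : ℕ) {p q : ℕ × ℕ} (hpq : p ≠ q) (h : p.2 = q.2) :
    Disjoint (sigSeg t n p) (sigSeg t n q) := by
  refine Set.disjoint_left.2 fun z hp hq => hpq (Prod.ext ?_ h)
  obtain ⟨-, -, hp⟩ := mem_segment_strip_iff.1 hp
  obtain ⟨-, -, hq⟩ := mem_segment_strip_iff.1 hq
  rw [h] at hp
  have : (p.1 : ℝ) = q.1 := by linarith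
  exact_mod_cast this

theorem not_disjoint_sigSeg_of_snd_lt {t : ℕ} (n : ℕ) {p q : ℕ × ℕ}
    (hp : p.1 ∈ Finset.Icc 1 t) (hq : q.1 ∈ Finset.Icc 1 t) (h : p.2 < q.2) :
    ¬ Disjoint (sigSeg t n p) (sigSeg t n q) := by
  obtain ⟨hp1, hpt⟩ := Finset.mem_Icc.1 hp
  obtain ⟨hq1, hqt⟩ := Finset.mem_Icc.1 hq
  rify at hp1 hpt hq1 hqt
  have hj : (p.2 : ℝ) + 1 ≤ q.2 := by exact_mod_cast h
  have hmul := mul_le_mul_of_nonneg_right hj (Nat.cast_nonneg (α := ℝ) t)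
  exact not_disjoint_segment_strip (by linarith) (by linarith)

theorem snd_eq_of_disjoint_sigSeg {t n : ℕ} {p q : ℕ × ℕ}
    (hp : p.1 ∈ Finset.Icc 1 t) (hq : q.1 ∈ Finset.Icc 1 t)
    (h : Disjoint (sigSeg t n p) (sigSeg t n q)) : p.2 = q.2 := by
  rcases lt_trichotomy p.2 q.2 with hlt | heq | hlt
  · exact absurd h (not_disjoint_sigSeg_of_snd_lt n hp hq hlt)
  · exact heq
  · exact absurd h.symm (not_disjoint_sigSeg_of_snd_lt n hq hp hlt)

/-- For a nonempty S ⊆ {1,…,t} × {1,…,n}, the maximum cardinality of a subset T ⊆ S whose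
segments σ(i,j), (i,j) ∈ T, are pairwise disjoint equals the maximum over j ∈ {1,…,n} of the
number of indices i with (i,j) ∈ S. -/
theorem stmt_2 (t n : ℕ) (ht : 1 ≤ t) (hn : 1 ≤ n)
    (S : Finset (ℕ × ℕ)) (hS : S ⊆ Finset.Icc 1 t ×ˢ Finset.Icc 1 n) (hne : S.Nonempty) :
    ((S.powerset.filter fun T : Finset (ℕ × ℕ) =>
        (↑T : Set (ℕ × ℕ)).Pairwise fun p q => Disjoint (sigSeg t n p) (sigSeg t n q)).sup
      Finset.card)
    = (Finset.Icc 1 n).sup fun j => (S.filter fun p => p.2 = j).card := by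
  refine le_antisymm (Finset.sup_le fun T hT => ?_) (Finset.sup_le fun j _ => ?_)
  · obtain ⟨hTS, hdisj⟩ := Finset.mem_filter.1 hT
    rw [Finset.mem_powerset] at hTS
    rcases T.eq_empty_or_nonempty with rfl | ⟨p, hp⟩
    · simp
    have hpS := Finset.mem_product.1 (hS (hTS hp))
    refine le_trans (Finset.card_le_card fun q hq => ?_)
      (Finset.le_sup (f := fun j => (S.filter fun p => p.2 = j).card) hpS.2)
    refine Finset.mem_filter.2 ⟨hTS hq, ?_⟩
    by_cases hqp : q = p
    · rw [hqp]
    · exact snd_eq_of_disjoint_sigSeg (Finset.mem_product.1 (hS (hTS hq))).1 hpS.1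
        (hdisj hq hp hqp)
  · refine Finset.le_sup (f := Finset.card) (Finset.mem_filter.2
      ⟨Finset.mem_powerset.2 (Finset.filter_subset _ _), fun p hp q hq hpq => ?_⟩)
    exact disjoint_sigSeg_of_snd_eq t n hpq
      ((Finset.mem_filter.1 hp).2.trans (Finset.mem_filter.1 hq).2.symm)
end

section
/- Let t ≥ 2 and n ≥ 1 be integers, and for 1 ≤ i ≤ t, 1 ≤ j ≤ n let σ(i,j) be the closed segment in ℝ² from ((j−1)·t + i, 1) to ((n−j)·t + i, 0). Let S be a nonempty subset of {1,…,t} × {1,…,n} such that for every j ∈ {1,…,n} the count c_j = |{i : (i,j) ∈ S}| lies in {0, 1, t}. If there exists j with c_j = t, then the maximum cardinality of a subset of {σ(i,j) : (i,j) ∈ S} consisting of pairwise disjoint segments equals t; otherwise this maximum equals 1. -/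
open scoped Classical

theorem not_disjoint_segment_of_crossing {a b c d : ℝ} (hac : a < c) (hdb : d < b) :
    ¬ Disjoint (segment ℝ ((a, 1) : ℝ × ℝ) (b, 0)) (segment ℝ ((c, 1) : ℝ × ℝ) (d, 0)) := by
  have hpos : 0 < (c - a) + (b - d) := by linarith
  have hleft : 0 ≤ (b - d) / ((c - a) + (b - d)) := div_nonneg (by linarith) hpos.le
  have hright : 0 ≤ (c - a) / ((c - a) + (b - d)) := div_nonneg (by linarith) hpos.le
  have hsum : (b - d) / ((c - a) + (b - d)) + (c - a) / ((c - a) + (b - d)) = 1 := by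
    field_simp
    ring
  refine Set.not_disjoint_iff.2 ⟨_, ⟨_, _, hleft, hright, hsum, rfl⟩,
    ⟨_, _, hleft, hright, hsum, ?_⟩⟩
  ext
  · simp only [Prod.fst_add, Prod.smul_fst, smul_eq_mul]
    field_simp
    ring
  · simp

theorem disjoint_segment_of_translate {a b c d : ℝ} (hac : a ≠ c) (h : c - a = d - b) :
    Disjoint (segment ℝ ((a, 1) : ℝ × ℝ) (b, 0)) (segment ℝ ((c, 1) : ℝ × ℝ) (d, 0)) := by
  rw [Set.disjoint_left]
  rintro _ ⟨u, v, -, -, huv, rfl⟩ ⟨u', v', -, -, huv', he⟩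
  simp only [Prod.smul_mk, smul_eq_mul, Prod.mk_add_mk, Prod.mk.injEq, mul_one, mul_zero,
    add_zero] at he
  obtain ⟨hx, rfl⟩ := he
  obtain rfl : v' = v := by linarith
  apply hac
  obtain rfl : d = b + (c - a) := by linarith
  linear_combination -hx + (c - a) * huv

theorem sigSeg_not_disjoint_of_snd_lt {t n : ℕ} {p q : ℕ × ℕ} (hp : p.1 ∈ Finset.Icc 1 t)
    (hq : q.1 ∈ Finset.Icc 1 t) (h : p.2 < q.2) :
    ¬ Disjoint (sigSeg t n p) (sigSeg t n q) := by
  rw [Finset.mem_Icc] at hp hq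
  have hp1 : (1 : ℝ) ≤ p.1 := by exact_mod_cast hp.1
  have hpt : (p.1 : ℝ) ≤ t := by exact_mod_cast hp.2
  have hq1 : (1 : ℝ) ≤ q.1 := by exact_mod_cast hq.1
  have hqt : (q.1 : ℝ) ≤ t := by exact_mod_cast hq.2
  have hpq : (p.2 : ℝ) + 1 ≤ q.2 := by exact_mod_cast h
  have hgap : 0 ≤ ((q.2 : ℝ) - p.2 - 1) * t := mul_nonneg (by linarith) (by linarith)
  exact not_disjoint_segment_of_crossing (by linarith) (by linarith)

theorem sigSeg_disjoint_of_snd_eq {t n : ℕ} {p q : ℕ × ℕ} (hne : p ≠ q) (h : p.2 = q.2) :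
    Disjoint (sigSeg t n p) (sigSeg t n q) := by
  have hfst : (p.1 : ℝ) ≠ q.1 := fun he => hne (Prod.ext (by exact_mod_cast he) h)
  unfold sigSeg
  rw [h]
  exact disjoint_segment_of_translate (fun he => hfst (by linarith)) (by ring)

theorem snd_eq_of_pairwise_disjoint_sigSeg {t n : ℕ} {T : Finset (ℕ × ℕ)}
    (hT : ∀ p ∈ T, p.1 ∈ Finset.Icc 1 t)
    (hdisj : (↑T : Set (ℕ × ℕ)).Pairwise fun p q => Disjoint (sigSeg t n p) (sigSeg t n q))
    {p q : ℕ × ℕ} (hp : p ∈ T) (hq : q ∈ T) : p.2 = q.2 := by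
  by_contra hpq
  have hne : p ≠ q := fun h => hpq (congrArg Prod.snd h)
  rcases lt_or_gt_of_ne hpq with h | h
  · exact sigSeg_not_disjoint_of_snd_lt (hT p hp) (hT q hq) h (hdisj hp hq hne)
  · exact sigSeg_not_disjoint_of_snd_lt (hT q hq) (hT p hp) h (hdisj hq hp hne.symm)

/-- Pairwise disjoint subfamilies are exactly those lying in one group, so a maximum one has
the size of the largest group. -/
theorem sup_card_pairwise_disjoint_sigSeg_eq {t n m : ℕ} {S : Finset (ℕ × ℕ)}
    (hS : ∀ p ∈ S, p.1 ∈ Finset.Icc 1 t)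
    (hle : ∀ p ∈ S, (S.filter fun q => q.2 = p.2).card ≤ m)
    (hex : ∃ j, (S.filter fun q => q.2 = j).card = m) :
    ((S.powerset.filter fun T : Finset (ℕ × ℕ) =>
      (↑T : Set (ℕ × ℕ)).Pairwise fun p q => Disjoint (sigSeg t n p) (sigSeg t n q)).sup
        Finset.card) = m := by
  apply le_antisymm
  · refine Finset.sup_le fun T hT => ?_
    rw [Finset.mem_filter, Finset.mem_powerset] at hT
    obtain ⟨hTS, hdisj⟩ := hT
    rcases T.eq_empty_or_nonempty with rfl | ⟨p, hp⟩
    · simp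
    · refine (Finset.card_le_card fun q hq => ?_).trans (hle p (hTS hp))
      exact Finset.mem_filter.2 ⟨hTS hq,
        snd_eq_of_pairwise_disjoint_sigSeg (fun r hr => hS r (hTS hr)) hdisj hq hp⟩
  · obtain ⟨j, rfl⟩ := hex
    refine Finset.le_sup (f := Finset.card) (Finset.mem_filter.2
      ⟨Finset.mem_powerset.2 (Finset.filter_subset _ _), fun p hp q hq hne => ?_⟩)
    rw [Finset.mem_coe, Finset.mem_filter] at hp hq
    exact sigSeg_disjoint_of_snd_eq hne (hp.2.trans hq.2.symm)

/-- Let t ≥ 2, and S ⊆ {1,…,t} × {1,…,n} nonempty such that each group count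
c_j = |{i : (i,j) ∈ S}| lies in {0,1,t}.  If some c_j = t then the maximum number of pairwise
disjoint segments among {σ(i,j) : (i,j) ∈ S} equals t; otherwise it equals 1. -/
theorem stmt_3 (t n : ℕ) (ht : 2 ≤ t) (hn : 1 ≤ n)
    (S : Finset (ℕ × ℕ)) (hS : S ⊆ Finset.Icc 1 t ×ˢ Finset.Icc 1 n) (hne : S.Nonempty)
    (hpromise : ∀ j, 1 ≤ j → j ≤ n →
      (S.filter fun p => p.2 = j).card = 0 ∨ (S.filter fun p => p.2 = j).card = 1 ∨
        (S.filter fun p => p.2 = j).card = t) :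
    ((∃ j, 1 ≤ j ∧ j ≤ n ∧ (S.filter fun p => p.2 = j).card = t) →
      ((S.powerset.filter fun T : Finset (ℕ × ℕ) =>
          (↑T : Set (ℕ × ℕ)).Pairwise fun p q => Disjoint (sigSeg t n p) (sigSeg t n q)).sup
        Finset.card) = t) ∧
    ((¬ ∃ j, 1 ≤ j ∧ j ≤ n ∧ (S.filter fun p => p.2 = j).card = t) →
      ((S.powerset.filter fun T : Finset (ℕ × ℕ) =>
          (↑T : Set (ℕ × ℕ)).Pairwise fun p q => Disjoint (sigSeg t n p) (sigSeg t n q)).sup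
        Finset.card) = 1) := by
  have hfst : ∀ p ∈ S, p.1 ∈ Finset.Icc 1 t := fun p hp => (Finset.mem_product.1 (hS hp)).1
  have hsnd : ∀ p ∈ S, 1 ≤ p.2 ∧ p.2 ≤ n := fun p hp =>
    Finset.mem_Icc.1 (Finset.mem_product.1 (hS hp)).2
  constructor
  · rintro ⟨j, -, -, hj⟩
    refine sup_card_pairwise_disjoint_sigSeg_eq hfst (fun p hp => ?_) ⟨j, hj⟩
    have := hpromise p.2 (hsnd p hp).1 (hsnd p hp).2
    omega
  · intro hno
    have hone : ∀ p ∈ S, (S.filter fun q => q.2 = p.2).card = 1 := fun p hp => by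
      rcases hpromise p.2 (hsnd p hp).1 (hsnd p hp).2 with h | h | h
      · exact absurd rfl (Finset.filter_eq_empty_iff.1 (Finset.card_eq_zero.1 h) hp)
      · exact h
      · exact absurd ⟨p.2, (hsnd p hp).1, (hsnd p hp).2, h⟩ hno
    obtain ⟨p, hp⟩ := hne
    exact sup_card_pairwise_disjoint_sigSeg_eq hfst (fun q hq => (hone q hq).le) ⟨p.2, hone p hp⟩
end

section
/- Let t ≥ 1 and n ≥ 1 be integers. For every pair (i, j) with 1 ≤ i ≤ t and 1 ≤ j ≤ n, let τ(i,j) be the closed segment in ℝ² from ((j−1)·t + i, 1) to ((j−1)·t + (t + 1 − i), 0). Then for any two distinct pairs (i, j) ≠ (i', j'), the segments τ(i,j) and τ(i',j') intersect if and only if j = j'; if j ≠ j', they are disjoint. -/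
/-- The point at height `1 / 2` above the centre of `[c, c + s + 1]` lies on every segment from
`(c + a, 1)` to the mirror image `(c + (s + 1 - a), 0)`. -/
theorem midpoint_mem_mirrored_segment (c s a : ℝ) :
    ((c + (s + 1) / 2, 1 / 2) : ℝ × ℝ) ∈
      segment ℝ ((c + a, 1) : ℝ × ℝ) ((c + (s + 1 - a), 0) : ℝ × ℝ) := by
  refine ⟨1 / 2, 1 / 2, by norm_num, by norm_num, by norm_num, ?_⟩
  ext
  · simp only [Prod.fst_add, Prod.smul_fst, smul_eq_mul]
    ring
  · simp

theorem fst_mem_Icc_of_mem_mirrored_segment {c s a : ℝ} (ha : 1 ≤ a) (has : a ≤ s) {p : ℝ × ℝ}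
    (hp : p ∈ segment ℝ ((c + a, 1) : ℝ × ℝ) ((c + (s + 1 - a), 0) : ℝ × ℝ)) :
    p.1 ∈ Set.Icc (c + 1) (c + s) := by
  have hfst : p.1 ∈ segment ℝ (c + a) (c + (s + 1 - a)) :=
    (Prod.segment_subset _ _ hp).1
  refine (convex_Icc (c + 1) (c + s)).segment_subset ?_ ?_ hfst <;>
    constructor <;> linarith

/-- The strips `[(j - 1) t + 1, j t]` are pairwise disjoint. -/
theorem le_of_mem_strips {t j k : ℕ} {x : ℝ}
    (hj : x ∈ Set.Icc (((j : ℝ) - 1) * t + 1) (((j : ℝ) - 1) * t + t))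
    (hk : x ∈ Set.Icc (((k : ℝ) - 1) * t + 1) (((k : ℝ) - 1) * t + t)) : j ≤ k := by
  by_contra! hkj
  have h : (k : ℝ) + 1 ≤ j := by exact_mod_cast hkj
  nlinarith [hj.1, hk.2, mul_le_mul_of_nonneg_right h (Nat.cast_nonneg (α := ℝ) t)]


/-- For 1 ≤ i,i' ≤ t and 1 ≤ j,j' ≤ n, the mirrored segments τ(i,j) from ((j−1)t+i, 1) to
((j−1)t+(t+1−i), 0) and τ(i',j') intersect iff j = j' (for distinct pairs (i,j) ≠ (i',j')). -/
theorem stmt_4 (t n : ℕ) (ht : 1 ≤ t) (hn : 1 ≤ n)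
    (i j i' j' : ℕ)
    (hi1 : 1 ≤ i) (hit : i ≤ t) (hj1 : 1 ≤ j) (hjn : j ≤ n)
    (hi1' : 1 ≤ i') (hit' : i' ≤ t) (hj1' : 1 ≤ j') (hjn' : j' ≤ n)
    (hne : (i, j) ≠ (i', j')) :
    (segment ℝ ((((j : ℝ) - 1) * t + i, 1) : ℝ × ℝ)
        ((((j : ℝ) - 1) * t + ((t : ℝ) + 1 - i), 0) : ℝ × ℝ) ∩
      segment ℝ ((((j' : ℝ) - 1) * t + i', 1) : ℝ × ℝ)
        ((((j' : ℝ) - 1) * t + ((t : ℝ) + 1 - i'), 0) : ℝ × ℝ)).Nonempty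
      ↔ j = j' := by
  have mem_strip {a b : ℕ} (ha : 1 ≤ a) (hat : a ≤ t) {p : ℝ × ℝ}
      (hp : p ∈ segment ℝ ((((b : ℝ) - 1) * t + a, 1) : ℝ × ℝ)
        ((((b : ℝ) - 1) * t + ((t : ℝ) + 1 - a), 0) : ℝ × ℝ)) :=
    fst_mem_Icc_of_mem_mirrored_segment (by exact_mod_cast ha) (by exact_mod_cast hat) hp
  constructor
  · rintro ⟨p, hp, hp'⟩
    have h := mem_strip hi1 hit hp
    have h' := mem_strip hi1' hit' hp'
    exact le_antisymm (le_of_mem_strips h h') (le_of_mem_strips h' h)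
  · rintro rfl
    exact ⟨_, midpoint_mem_mirrored_segment _ _ _, midpoint_mem_mirrored_segment _ _ _⟩
end

section
/- Let t ≥ 1 and n ≥ 1 be integers. For 1 ≤ i ≤ t, 1 ≤ j ≤ n let σ(i,j) be the closed segment in ℝ² from ((j−1)·t + i, 1) to ((n−j)·t + i, 0), and let τ(i,j) be the closed segment from ((j−1)·t + i, 1) to ((j−1)·t + (t + 1 − i), 0). Then for any two distinct pairs (i, j) ≠ (i', j'), the segments σ(i,j) and σ(i',j') are disjoint if and only if the segments τ(i,j) and τ(i',j') intersect. In particular, the intersection graph of the family {τ(i,j)} is the complement of the intersection graph of the family {σ(i,j)}. -/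
/-- Two segments joining the line `y = 1` to the line `y = 0` meet iff the order of their upper
endpoints is not strictly preserved by their lower endpoints. -/
theorem segment_inter_segment_nonempty_iff (a b a' b' : ℝ) :
    (segment ℝ ((a, 1) : ℝ × ℝ) ((b, 0) : ℝ × ℝ) ∩
      segment ℝ ((a', 1) : ℝ × ℝ) ((b', 0) : ℝ × ℝ)).Nonempty ↔ (a - a') * (b - b') ≤ 0 := by
  constructor
  · rintro ⟨z, ⟨p, q, hp, hq, hpq, rfl⟩, ⟨p', q', -, -, hpq', h⟩⟩
    simp only [Prod.smul_mk, Prod.mk_add_mk, smul_eq_mul, mul_one, mul_zero, add_zero,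
      Prod.mk.injEq] at h
    obtain ⟨h1, rfl⟩ := h
    obtain rfl : q' = q := by linarith
    have h0 : p' * (a - a') + q' * (b - b') = 0 := by linarith
    have hu : p' * ((a - a') * (b - b')) = -(q' * (b - b') ^ 2) := by
      linear_combination (b - b') * h0
    have hv : q' * ((a - a') * (b - b')) = -(p' * (a - a') ^ 2) := by
      linear_combination (a - a') * h0
    have hsum : (a - a') * (b - b') = -(q' * (b - b') ^ 2) + -(p' * (a - a') ^ 2) := by
      rw [← hu, ← hv, ← add_mul, hpq, one_mul]
    rw [hsum]
    linarith [mul_nonneg hq (sq_nonneg (b - b')), mul_nonneg hp (sq_nonneg (a - a'))]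
  · intro h
    obtain ⟨p, q, hp, hq, hpq, h0⟩ : ∃ p q : ℝ, 0 ≤ p ∧ 0 ≤ q ∧ p + q = 1 ∧
        p * (a - a') + q * (b - b') = 0 := by
      rcases eq_or_ne (b - b') (a - a') with he | he
      · have ha : a - a' = 0 := by
          rw [he] at h
          exact mul_self_eq_zero.mp (le_antisymm h (mul_self_nonneg _))
        exact ⟨1, 0, by simp [ha]⟩
      · have hd : (b - b') - (a - a') ≠ 0 := sub_ne_zero.mpr he
        have hd2 : 0 < ((b - b') - (a - a')) ^ 2 := by positivity
        refine ⟨(b - b') * ((b - b') - (a - a')) / ((b - b') - (a - a')) ^ 2,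
          -(a - a') * ((b - b') - (a - a')) / ((b - b') - (a - a')) ^ 2,
          div_nonneg (by nlinarith [sq_nonneg (b - b')]) hd2.le,
          div_nonneg (by nlinarith [sq_nonneg (a - a')]) hd2.le, ?_, ?_⟩
        · field_simp
          ring
        · field_simp
          ring
    refine ⟨p • (a, 1) + q • (b, 0), ⟨p, q, hp, hq, hpq, rfl⟩, ⟨p, q, hp, hq, hpq, ?_⟩⟩
    ext
    · simp only [Prod.smul_mk, Prod.mk_add_mk, smul_eq_mul]
      linarith
    · simp

/-- The squared difference of two indices in `{1, …, t}` differs from every `(m * t) ^ 2`, unless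
both the indices agree and `m = 0`. -/
theorem sq_sub_ne_sq_mul {t i i' j j' : ℕ} (hi1 : 1 ≤ i) (hit : i ≤ t) (hi1' : 1 ≤ i')
    (hit' : i' ≤ t) (hne : (i, j) ≠ (i', j')) :
    ((i : ℝ) - i') ^ 2 ≠ (((j : ℝ) - j') * t) ^ 2 := by
  intro h
  have hz : ((i : ℤ) - i') ^ 2 = (((j : ℤ) - j') * t) ^ 2 := by exact_mod_cast h
  have hdvd : (t : ℤ) ∣ (i : ℤ) - i' := by
    rcases sq_eq_sq_iff_eq_or_eq_neg.mp hz with h | h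
    · exact ⟨(j : ℤ) - j', by rw [h, mul_comm]⟩
    · exact ⟨-((j : ℤ) - j'), by rw [h]; ring⟩
  have hii : (i : ℤ) - i' = 0 :=
    Int.eq_zero_of_abs_lt_dvd hdvd (abs_lt.mpr ⟨by omega, by omega⟩)
  have ht : (t : ℤ) ≠ 0 := by omega
  rw [hii, zero_pow two_ne_zero, eq_comm, sq_eq_zero_iff, mul_eq_zero, or_iff_left ht] at hz
  exact hne (Prod.ext (by dsimp only; omega) (by dsimp only; omega))


/-- For distinct pairs (i,j) ≠ (i',j') with 1 ≤ i,i' ≤ t and 1 ≤ j,j' ≤ n, the segments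
σ(i,j) from ((j−1)t+i, 1) to ((n−j)t+i, 0) are disjoint iff the mirrored segments τ(i,j)
from ((j−1)t+i, 1) to ((j−1)t+(t+1−i), 0) intersect: the intersection graph of the τ's is
the complement of the intersection graph of the σ's. -/
theorem stmt_5 (t n : ℕ) (ht : 1 ≤ t) (hn : 1 ≤ n)
    (i j i' j' : ℕ)
    (hi1 : 1 ≤ i) (hit : i ≤ t) (hj1 : 1 ≤ j) (hjn : j ≤ n)
    (hi1' : 1 ≤ i') (hit' : i' ≤ t) (hj1' : 1 ≤ j') (hjn' : j' ≤ n)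
    (hne : (i, j) ≠ (i', j')) :
    Disjoint
      (segment ℝ ((((j : ℝ) - 1) * t + i, 1) : ℝ × ℝ) ((((n : ℝ) - j) * t + i, 0) : ℝ × ℝ))
      (segment ℝ ((((j' : ℝ) - 1) * t + i', 1) : ℝ × ℝ) ((((n : ℝ) - j') * t + i', 0) : ℝ × ℝ))
    ↔
    (segment ℝ ((((j : ℝ) - 1) * t + i, 1) : ℝ × ℝ)
        ((((j : ℝ) - 1) * t + ((t : ℝ) + 1 - i), 0) : ℝ × ℝ) ∩
      segment ℝ ((((j' : ℝ) - 1) * t + i', 1) : ℝ × ℝ)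
        ((((j' : ℝ) - 1) * t + ((t : ℝ) + 1 - i'), 0) : ℝ × ℝ)).Nonempty := by
  rw [Set.disjoint_iff_inter_eq_empty, ← Set.not_nonempty_iff_eq_empty,
    segment_inter_segment_nonempty_iff, segment_inter_segment_nonempty_iff, not_le]
  have h := sq_sub_ne_sq_mul (j := j) (j' := j') hi1 hit hi1' hit' hne
  have hσ : (((j : ℝ) - 1) * t + i - (((j' : ℝ) - 1) * t + i')) *
      (((n : ℝ) - j) * t + i - (((n : ℝ) - j') * t + i')) =
      ((i : ℝ) - i') ^ 2 - (((j : ℝ) - j') * t) ^ 2 := by ring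
  have hτ : (((j : ℝ) - 1) * t + i - (((j' : ℝ) - 1) * t + i')) *
      (((j : ℝ) - 1) * t + ((t : ℝ) + 1 - i) - (((j' : ℝ) - 1) * t + ((t : ℝ) + 1 - i'))) =
      (((j : ℝ) - j') * t) ^ 2 - ((i : ℝ) - i') ^ 2 := by ring
  rw [hσ, hτ, sub_pos, sub_nonpos]
  exact ⟨le_of_lt, fun hle => lt_of_le_of_ne hle h.symm⟩
end

section
/- Let t ≥ 1 and n ≥ 1 be integers, and for 1 ≤ i ≤ t, 1 ≤ j ≤ n let τ(i,j) be the closed segment in ℝ² from ((j−1)·t + i, 1) to ((j−1)·t + (t + 1 − i), 0). Let S be a nonempty subset of {1,…,t} × {1,…,n}. Then the maximum cardinality of a subset T ⊆ S such that the segments {τ(i,j) : (i,j) ∈ T} pairwise intersect equals the maximum over j ∈ {1,…,n} of the number of indices i with (i,j) ∈ S. -/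
open scoped Classical

/-- The mirrored segment τ(i,j) from ((j−1)t+i, 1) to ((j−1)t+(t+1−i), 0), for p = (i,j). -/
noncomputable def tauSeg (t : ℕ) (p : ℕ × ℕ) : Set (ℝ × ℝ) :=
  segment ℝ ((((p.2 : ℝ) - 1) * t + p.1, 1) : ℝ × ℝ)
    ((((p.2 : ℝ) - 1) * t + ((t : ℝ) + 1 - p.1), 0) : ℝ × ℝ)

theorem midpoint_mem_tauSeg (t : ℕ) (p : ℕ × ℕ) :
    (((p.2 : ℝ) - 1) * t + (t + 1) / 2, 1 / 2) ∈ tauSeg t p := by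
  refine ⟨1 / 2, 1 / 2, by norm_num, by norm_num, by norm_num, ?_⟩
  ext
  · simp only [Prod.fst_add, Prod.smul_fst, smul_eq_mul]
    ring
  · simp

theorem fst_mem_Icc_of_mem_tauSeg {t : ℕ} {p : ℕ × ℕ} (hp : p.1 ∈ Finset.Icc 1 t)
    {x : ℝ × ℝ} (hx : x ∈ tauSeg t p) :
    x.1 ∈ Set.Icc (((p.2 : ℝ) - 1) * t + 1) (p.2 * t) := by
  obtain ⟨a, b, ha, hb, hab, rfl⟩ := hx
  obtain ⟨h1, h2⟩ := Finset.mem_Icc.1 hp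
  have h1' : (1 : ℝ) ≤ p.1 := by exact_mod_cast h1
  have h2' : (p.1 : ℝ) ≤ t := by exact_mod_cast h2
  obtain rfl : b = 1 - a := by linarith
  simp only [Prod.fst_add, Prod.smul_fst, smul_eq_mul]
  constructor <;> nlinarith

theorem snd_le_of_tauSeg_inter_nonempty {t : ℕ} {p q : ℕ × ℕ} (hp : p.1 ∈ Finset.Icc 1 t)
    (hq : q.1 ∈ Finset.Icc 1 t) (h : (tauSeg t p ∩ tauSeg t q).Nonempty) : p.2 ≤ q.2 := by
  obtain ⟨x, hxp, hxq⟩ := h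
  have hlow := (fst_mem_Icc_of_mem_tauSeg hp hxp).1
  have hupp := (fst_mem_Icc_of_mem_tauSeg hq hxq).2
  by_contra! hlt
  have hlt' : (q.2 : ℝ) + 1 ≤ p.2 := by exact_mod_cast hlt
  have ht : (0 : ℝ) ≤ t := t.cast_nonneg
  nlinarith

theorem tauSeg_inter_nonempty_iff {t : ℕ} {p q : ℕ × ℕ} (hp : p.1 ∈ Finset.Icc 1 t)
    (hq : q.1 ∈ Finset.Icc 1 t) : (tauSeg t p ∩ tauSeg t q).Nonempty ↔ p.2 = q.2 := by
  refine ⟨fun h => le_antisymm (snd_le_of_tauSeg_inter_nonempty hp hq h)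
    (snd_le_of_tauSeg_inter_nonempty hq hp (Set.inter_comm _ _ ▸ h)), fun h => ?_⟩
  exact ⟨_, midpoint_mem_tauSeg t p, h ▸ midpoint_mem_tauSeg t q⟩

/-- For a nonempty S ⊆ {1,…,t} × {1,…,n}, the maximum cardinality of a subset T ⊆ S whose
segments τ(i,j), (i,j) ∈ T, pairwise intersect equals the maximum over j ∈ {1,…,n} of the
number of indices i with (i,j) ∈ S. -/
theorem stmt_6 (t n : ℕ) (ht : 1 ≤ t) (hn : 1 ≤ n)
    (S : Finset (ℕ × ℕ)) (hS : S ⊆ Finset.Icc 1 t ×ˢ Finset.Icc 1 n) (hne : S.Nonempty) :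
    ((S.powerset.filter fun T : Finset (ℕ × ℕ) =>
        (↑T : Set (ℕ × ℕ)).Pairwise fun p q => (tauSeg t p ∩ tauSeg t q).Nonempty).sup
      Finset.card)
    = (Finset.Icc 1 n).sup fun j => (S.filter fun p => p.2 = j).card := by
  have hfst : ∀ p ∈ S, p.1 ∈ Finset.Icc 1 t := fun p hp => (Finset.mem_product.1 (hS hp)).1
  have hsnd : ∀ p ∈ S, p.2 ∈ Finset.Icc 1 n := fun p hp => (Finset.mem_product.1 (hS hp)).2
  apply le_antisymm
  · refine Finset.sup_le fun T hT => ?_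
    obtain ⟨hTS, hpair⟩ := Finset.mem_filter.1 hT
    rw [Finset.mem_powerset] at hTS
    obtain rfl | ⟨p, hp⟩ := T.eq_empty_or_nonempty
    · simp
    refine le_trans (Finset.card_le_card fun q hq => Finset.mem_filter.2 ⟨hTS hq, ?_⟩)
      (Finset.le_sup (f := fun j => (S.filter fun p => p.2 = j).card) (hsnd p (hTS hp)))
    by_cases hqp : q = p
    · rw [hqp]
    · exact (tauSeg_inter_nonempty_iff (hfst q (hTS hq)) (hfst p (hTS hp))).1
        (hpair hq hp hqp)
  · refine Finset.sup_le fun j _ => Finset.le_sup (f := Finset.card) ?_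
    refine Finset.mem_filter.2
      ⟨Finset.mem_powerset.2 (Finset.filter_subset _ _), fun p hp q hq _ => ?_⟩
    obtain ⟨hpS, hpj⟩ := Finset.mem_filter.1 hp
    obtain ⟨hqS, hqj⟩ := Finset.mem_filter.1 hq
    exact (tauSeg_inter_nonempty_iff (hfst p hpS) (hfst q hqS)).2 (hpj.trans hqj.symm)
end
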